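/- arXiv:cond-mat/0607615 — 2 statements merged into one kernel-verified Lean document; each statement's English description precedes it below -/
import Mathlib

section
/- Assume that for every β in an open interval I ⊂ (0,∞) the limit α(β) = lim_{M→∞} α_M(β) exists, and that α is differentiable at a point β₀ ∈ I. Let Ĵ = (Ĵ_{kl}) be i.i.d. standard Gaussians independent of J and Ĥ(τ) = −(1/M) Σ_{k,l} Ĵ_{kl} τ_k τ_l. Then for every integer N ≥ 1 and every β' ∈ ℝ, lim_{M→∞} (1/N) E[ln ω_{β₀}(exp(−β'√(N/2) Ĥ))] = (β'²/(4β₀)) α'(β₀); in particular the limit is a monomial of degree two in β' and does not depend on N. -/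
open MeasureTheory ProbabilityTheory Filter

noncomputable section

/-- spin value of a Boolean configuration coordinate: `±1`. -/
def spinval (b : Bool) : ℝ := if b then 1 else -1

/-- Boltzmann weight of a configuration `τ`. -/
def boltzW (M : ℕ) (β : ℝ) (J : (Fin M × Fin M) → ℝ) (τ : Fin M → Bool) : ℝ :=
  Real.exp ((β / Real.sqrt M) *
    ∑ k : Fin M, ∑ l : Fin M, J (k, l) * spinval (τ k) * spinval (τ l))

/-- Partition function of the mean-field model with full-double-sum Gaussian couplings. -/
def ZSK (M : ℕ) (β : ℝ) (J : (Fin M × Fin M) → ℝ) : ℝ :=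
  ∑ τ : Fin M → Bool, boltzW M β J τ

/-- i.i.d. standard Gaussian couplings `(J_{kl})_{1≤k,l≤M}`. -/
def couplingLaw (M : ℕ) : Measure ((Fin M × Fin M) → ℝ) :=
  Measure.pi fun _ : Fin M × Fin M => gaussianReal 0 1

/-- Quenched pressure `α_M(β) = (1/M) E[ln Z_M(β;J)]`. -/
def quenchedPressure (M : ℕ) (β : ℝ) : ℝ :=
  (1 / (M : ℝ)) * ∫ J, Real.log (ZSK M β J) ∂(couplingLaw M)

/-- The internal-energy field `Ĥ(τ) = −(1/M) Σ_{k,l} Ĵ_{kl} τ_k τ_l`. -/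
def Hhat (M : ℕ) (Jh : (Fin M × Fin M) → ℝ) (τ : Fin M → Bool) : ℝ :=
  -(1 / (M : ℝ)) * ∑ k : Fin M, ∑ l : Fin M, Jh (k, l) * spinval (τ k) * spinval (τ l)

/-- Joint law of the two independent i.i.d. standard Gaussian families `(J, Ĵ)`. -/
def jointLaw (M : ℕ) : Measure (((Fin M × Fin M) → ℝ) × ((Fin M × Fin M) → ℝ)) :=
  (couplingLaw M).prod (couplingLaw M)

/-- The function `u ↦ log ∑ i, exp (u i)`. -/
def logSumExp {ι : Type*} [Fintype ι] (u : ι → ℝ) : ℝ := Real.log (∑ i, Real.exp (u i))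

lemma convexOn_logSumExp {ι : Type*} [Fintype ι] [Nonempty ι] :
    ConvexOn ℝ Set.univ (logSumExp : (ι → ℝ) → ℝ) := by
  refine ⟨convex_univ, fun u _ v _ a b ha hb hab => ?_⟩
  have hpos : ∀ w : ι → ℝ, 0 < ∑ i, Real.exp (w i) := fun w =>
    Finset.sum_pos (fun i _ => Real.exp_pos _) Finset.univ_nonempty
  have hone : ∀ w : ι → ℝ, ∑ i, Real.exp (w i - logSumExp w) = 1 := fun w => by
    simp only [Real.exp_sub, ← Finset.sum_div, logSumExp, Real.exp_log (hpos w)]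
    exact div_self (hpos w).ne'
  have key : ∑ i, Real.exp ((a • u + b • v) i - (a * logSumExp u + b * logSumExp v)) ≤ 1 := by
    calc _ ≤ ∑ i, (a * Real.exp (u i - logSumExp u) + b * Real.exp (v i - logSumExp v)) := by
          refine Finset.sum_le_sum fun i _ => ?_
          have h := convexOn_exp.2 (Set.mem_univ (u i - logSumExp u))
            (Set.mem_univ (v i - logSumExp v)) ha hb hab
          simp only [smul_eq_mul, Pi.add_apply, Pi.smul_apply] at h ⊢
          convert h using 2
          ring
      _ = 1 := by
          rw [Finset.sum_add_distrib, ← Finset.mul_sum, ← Finset.mul_sum, hone, hone]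
          linarith
  simp only [Real.exp_sub, ← Finset.sum_div] at key
  rw [div_le_one (Real.exp_pos _)] at key
  exact (Real.log_le_iff_le_exp (hpos _)).2 key

lemma abs_logSumExp_le {ι : Type*} [Fintype ι] [Nonempty ι] {u : ι → ℝ} {B : ℝ}
    (hu : ∀ i, |u i| ≤ B) : |logSumExp u| ≤ Real.log (Fintype.card ι) + B := by
  have hc : (1 : ℝ) ≤ Fintype.card ι := by exact_mod_cast Fintype.card_pos
  have hpos : 0 < ∑ i, Real.exp (u i) :=
    Finset.sum_pos (fun i _ => Real.exp_pos _) Finset.univ_nonempty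
  rw [abs_le]
  constructor
  · have h : Real.exp (-B) ≤ ∑ i, Real.exp (u i) := by
      obtain ⟨i⟩ := ‹Nonempty ι›
      exact (Real.exp_le_exp.2 (abs_le.1 (hu i)).1).trans
        (Finset.single_le_sum (fun j _ => (Real.exp_pos (u j)).le) (Finset.mem_univ i))
    have h' := (Real.le_log_iff_exp_le hpos).2 h
    have := Real.log_nonneg hc
    unfold logSumExp
    linarith
  · rw [logSumExp, Real.log_le_iff_le_exp hpos, Real.exp_add,
      Real.exp_log (by linarith)]
    calc ∑ i, Real.exp (u i) ≤ ∑ _i : ι, Real.exp B :=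
          Finset.sum_le_sum fun i _ => Real.exp_le_exp.2 (abs_le.1 (hu i)).2
      _ = _ := by simp

lemma continuous_logSumExp {ι : Type*} [Fintype ι] [Nonempty ι] :
    Continuous (logSumExp : (ι → ℝ) → ℝ) := by
  refine Continuous.log (by fun_prop) fun u => ?_
  exact (Finset.sum_pos (fun i _ => Real.exp_pos _) Finset.univ_nonempty).ne'

/-- The energy `∑ x_{kl} τ_k τ_l` of each configuration `τ`, linear in the couplings `x`. -/
def energy (M : ℕ) : ((Fin M × Fin M) → ℝ) →ₗ[ℝ] ((Fin M → Bool) → ℝ) where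
  toFun x τ := ∑ k : Fin M, ∑ l : Fin M, x (k, l) * spinval (τ k) * spinval (τ l)
  map_add' x y := by
    ext τ
    simp [add_mul, Finset.sum_add_distrib]
  map_smul' c x := by
    ext τ
    simp [Finset.mul_sum, mul_assoc]

lemma energy_apply (M : ℕ) (x : (Fin M × Fin M) → ℝ) (τ : Fin M → Bool) :
    energy M x τ = ∑ k : Fin M, ∑ l : Fin M, x (k, l) * spinval (τ k) * spinval (τ l) := rfl

lemma abs_spinval (b : Bool) : |spinval b| = 1 := by
  cases b <;> simp [spinval]

lemma abs_energy_le (M : ℕ) (x : (Fin M × Fin M) → ℝ) (τ : Fin M → Bool) :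
    |energy M x τ| ≤ ∑ p, |x p| := by
  rw [energy_apply, Fintype.sum_prod_type]
  refine (Finset.abs_sum_le_sum_abs _ _).trans (Finset.sum_le_sum fun k _ => ?_)
  refine (Finset.abs_sum_le_sum_abs _ _).trans (Finset.sum_le_sum fun l _ => ?_)
  simp [abs_mul, abs_spinval]

/-- The log-partition function, as a function of the rescaled couplings. -/
def logPartition (M : ℕ) (x : (Fin M × Fin M) → ℝ) : ℝ := logSumExp (energy M x)

lemma continuous_logPartition (M : ℕ) : Continuous (logPartition M) :=
  continuous_logSumExp.comp (LinearMap.continuous_of_finiteDimensional (energy M))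

lemma convexOn_logPartition (M : ℕ) : ConvexOn ℝ Set.univ (logPartition M) :=
  convexOn_logSumExp.comp_linearMap (energy M)

instance (M : ℕ) : IsProbabilityMeasure (couplingLaw M) := by
  unfold couplingLaw
  infer_instance

lemma integrable_logPartition (M : ℕ) (c : ℝ) :
    Integrable (fun J => logPartition M (c • J)) (couplingLaw M) := by
  have hb : Integrable (fun J : (Fin M × Fin M) → ℝ =>
      Real.log (Fintype.card (Fin M → Bool)) + ∑ p, |(c • J) p|) (couplingLaw M) := by
    refine (integrable_const _).add (integrable_finsetSum _ fun p _ => ?_)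
    have hid : Integrable (fun x : ℝ => |c * x|) (gaussianReal 0 1) :=
      (((memLp_id_gaussianReal 1).integrable (by simp)).const_mul c).abs
    exact integrable_comp_eval (μ := fun _ : Fin M × Fin M => gaussianReal 0 1) (i := p) hid
  refine hb.mono' ?_ (Eventually.of_forall fun J => ?_)
  · exact ((continuous_logPartition M).comp (continuous_const_smul c)).aestronglyMeasurable
  · exact abs_logSumExp_le (abs_energy_le M _)

lemma boltzW_eq (M : ℕ) (β : ℝ) (J : (Fin M × Fin M) → ℝ) (τ : Fin M → Bool) :
    boltzW M β J τ = Real.exp (energy M ((β / Real.sqrt M) • J) τ) := by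
  rw [map_smul, Pi.smul_apply, smul_eq_mul, energy_apply, boltzW]

lemma log_ZSK (M : ℕ) (β : ℝ) (J : (Fin M × Fin M) → ℝ) :
    Real.log (ZSK M β J) = logPartition M ((β / Real.sqrt M) • J) := by
  simp only [ZSK, boltzW_eq, logPartition, logSumExp]

lemma convexOn_quenchedPressure (M : ℕ) : ConvexOn ℝ Set.univ (quenchedPressure M) := by
  refine ⟨convex_univ, fun x _ y _ a b ha hb hab => ?_⟩
  have hpt : ∀ J : (Fin M × Fin M) → ℝ,
      logPartition M (((a • x + b • y) / Real.sqrt M) • J) ≤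
        a * logPartition M ((x / Real.sqrt M) • J) +
          b * logPartition M ((y / Real.sqrt M) • J) := fun J => by
    have h := (convexOn_logPartition M).2 (Set.mem_univ ((x / Real.sqrt M) • J))
      (Set.mem_univ ((y / Real.sqrt M) • J)) ha hb hab
    have hlin : ((a • x + b • y) / Real.sqrt M) • J =
        a • (x / Real.sqrt M) • J + b • (y / Real.sqrt M) • J := by
      rw [smul_smul, smul_smul, ← add_smul]
      congr 1
      simp only [smul_eq_mul]
      ring
    rw [hlin]
    exact h
  have hi := integral_mono (integrable_logPartition M _)
    (((integrable_logPartition M _).const_mul a).add ((integrable_logPartition M _).const_mul b))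
    hpt
  rw [integral_add' ((integrable_logPartition M _).const_mul a)
    ((integrable_logPartition M _).const_mul b), integral_const_mul, integral_const_mul] at hi
  simp only [quenchedPressure, log_ZSK]
  have hM : (0 : ℝ) ≤ 1 / (M : ℝ) := by positivity
  refine (mul_le_mul_of_nonneg_left hi hM).trans (le_of_eq ?_)
  simp only [smul_eq_mul]
  ring

lemma map_gaussianReal_linear_comb (a b : ℝ) :
    ((gaussianReal 0 1).prod (gaussianReal 0 1)).map (fun p : ℝ × ℝ => a * p.1 + b * p.2) =
      (gaussianReal 0 1).map (fun x => Real.sqrt (a ^ 2 + b ^ 2) * x) := by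
  have h : ((gaussianReal 0 1).prod (gaussianReal 0 1)).map (fun p : ℝ × ℝ => a * p.1 + b * p.2) =
      Measure.conv ((gaussianReal 0 1).map (a * ·)) ((gaussianReal 0 1).map (b * ·)) := by
    rw [Measure.conv, Measure.map_prod_map _ _ (by fun_prop) (by fun_prop),
      Measure.map_map (by fun_prop) (by fun_prop)]
    rfl
  rw [h, gaussianReal_map_const_mul, gaussianReal_map_const_mul, gaussianReal_map_const_mul,
    gaussianReal_conv_gaussianReal]
  congr 1
  · simp
  · ext
    simp [Real.sq_sqrt (add_nonneg (sq_nonneg a) (sq_nonneg b))]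

lemma map_couplingLaw_linear_comb (M : ℕ) (a b : ℝ) :
    (jointLaw M).map (fun J => a • J.1 + b • J.2) =
      (couplingLaw M).map (fun J => Real.sqrt (a ^ 2 + b ^ 2) • J) := by
  have hmp := measurePreserving_arrowProdEquivProdArrow ℝ ℝ (Fin M × Fin M)
    (fun _ => gaussianReal 0 1) (fun _ => gaussianReal 0 1)
  have : IsProbabilityMeasure (((gaussianReal 0 1).prod (gaussianReal 0 1)).map
      (fun p : ℝ × ℝ => a * p.1 + b * p.2)) := Measure.isProbabilityMeasure_map (by fun_prop)
  have : IsProbabilityMeasure ((gaussianReal 0 1).map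
      (fun x => Real.sqrt (a ^ 2 + b ^ 2) * x)) := Measure.isProbabilityMeasure_map (by fun_prop)
  have h1 := Measure.pi_map_pi (ι := Fin M × Fin M)
    (μ := fun _ => (gaussianReal 0 1).prod (gaussianReal 0 1))
    (f := fun _ (p : ℝ × ℝ) => a * p.1 + b * p.2) (fun _ => by fun_prop)
  have h2 := Measure.pi_map_pi (ι := Fin M × Fin M) (μ := fun _ => gaussianReal 0 1)
    (f := fun _ (x : ℝ) => Real.sqrt (a ^ 2 + b ^ 2) * x) (fun _ => by fun_prop)
  simp only [map_gaussianReal_linear_comb] at h1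
  rw [← h2] at h1
  rw [jointLaw, couplingLaw, ← hmp.map_eq, Measure.map_map (by fun_prop) hmp.measurable]
  exact h1

lemma integral_logPartition_linear_comb (M : ℕ) (a b : ℝ) :
    ∫ J, logPartition M (a • J.1 + b • J.2) ∂(jointLaw M) =
      ∫ J, logPartition M (Real.sqrt (a ^ 2 + b ^ 2) • J) ∂(couplingLaw M) := by
  have hc := (continuous_logPartition M).measurable
  rw [← integral_map (φ := fun J : ((Fin M × Fin M) → ℝ) × ((Fin M × Fin M) → ℝ) =>
      a • J.1 + b • J.2) (by fun_prop) hc.aestronglyMeasurable, map_couplingLaw_linear_comb,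
    integral_map (by fun_prop) hc.aestronglyMeasurable]

lemma integrable_logPartition_linear_comb (M : ℕ) (a b : ℝ) :
    Integrable (fun J => logPartition M (a • J.1 + b • J.2)) (jointLaw M) := by
  have hc := (continuous_logPartition M).measurable
  have h := integrable_logPartition M (Real.sqrt (a ^ 2 + b ^ 2))
  refine (integrable_map_measure (f := fun J : ((Fin M × Fin M) → ℝ) × ((Fin M × Fin M) → ℝ) =>
      a • J.1 + b • J.2) hc.aestronglyMeasurable (by fun_prop)).1 ?_
  rw [map_couplingLaw_linear_comb]
  exact (integrable_map_measure hc.aestronglyMeasurable (by fun_prop)).2 h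

lemma integral_log_gibbs_average (M : ℕ) (hM : 1 ≤ M) (β b : ℝ) :
    ∫ J, Real.log ((∑ τ : Fin M → Bool, boltzW M β J.1 τ *
        Real.exp (-b * Hhat M J.2 τ)) / ZSK M β J.1) ∂(jointLaw M) =
      M * (quenchedPressure M (Real.sqrt (β ^ 2 + b ^ 2 / M)) - quenchedPressure M |β|) := by
  have hM0 : (0 : ℝ) < M := by exact_mod_cast hM
  have hpt : ∀ J : ((Fin M × Fin M) → ℝ) × ((Fin M × Fin M) → ℝ),
      Real.log ((∑ τ : Fin M → Bool, boltzW M β J.1 τ *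
        Real.exp (-b * Hhat M J.2 τ)) / ZSK M β J.1) =
      logPartition M ((β / Real.sqrt M) • J.1 + (b / M) • J.2) -
        logPartition M ((β / Real.sqrt M) • J.1 + (0 : ℝ) • J.2) := fun J => by
    have hnum : ∑ τ : Fin M → Bool, boltzW M β J.1 τ * Real.exp (-b * Hhat M J.2 τ) =
        ∑ τ, Real.exp (energy M ((β / Real.sqrt M) • J.1 + (b / M) • J.2) τ) := by
      refine Finset.sum_congr rfl fun τ _ => ?_
      rw [boltzW_eq, ← Real.exp_add, map_add, Pi.add_apply, map_smul _ (b / M : ℝ), Pi.smul_apply,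
        Hhat, ← energy_apply, smul_eq_mul]
      congr 2
      ring
    have h1 : ∑ τ, Real.exp (energy M ((β / Real.sqrt M) • J.1 + (b / M) • J.2) τ) ≠ 0 :=
      (Finset.sum_pos (fun i _ => Real.exp_pos _) Finset.univ_nonempty).ne'
    have h2 : ZSK M β J.1 ≠ 0 :=
      (Finset.sum_pos (fun i _ => Real.exp_pos _) Finset.univ_nonempty).ne'
    rw [hnum, Real.log_div h1 h2, log_ZSK, zero_smul, add_zero]
    rfl
  have hscale : Real.sqrt (β ^ 2 + b ^ 2 / M) / Real.sqrt M =
      Real.sqrt ((β / Real.sqrt M) ^ 2 + (b / M) ^ 2) := by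
    rw [← Real.sqrt_div' _ hM0.le, div_pow, Real.sq_sqrt hM0.le]
    congr 1
    field_simp
  have hscale0 : |β| / Real.sqrt M = Real.sqrt ((β / Real.sqrt M) ^ 2 + 0 ^ 2) := by
    rw [zero_pow two_ne_zero, add_zero, Real.sqrt_sq_eq_abs, abs_div,
      abs_of_nonneg (Real.sqrt_nonneg _)]
  simp only [hpt]
  rw [integral_sub (integrable_logPartition_linear_comb M _ _)
    (integrable_logPartition_linear_comb M _ _), integral_logPartition_linear_comb,
    integral_logPartition_linear_comb]
  simp only [quenchedPressure, log_ZSK, hscale, hscale0]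
  field_simp

/-- If convex functions `f n` converge pointwise near `x` to a function differentiable at `x`, then
their difference quotients along `y n ↓ x` converge to the derivative. -/
lemma tendsto_slope_of_convexOn {f : ℕ → ℝ → ℝ} (hf : ∀ n, ConvexOn ℝ Set.univ (f n))
    {g : ℝ → ℝ} {x d : ℝ} (hlim : ∀ᶠ z in nhds x, Tendsto (fun n => f n z) atTop (nhds (g z)))
    (hd : HasDerivAt g d x) {y : ℕ → ℝ} (hy : Tendsto y atTop (nhds x))
    (hyx : ∀ᶠ n in atTop, x < y n) :
    Tendsto (fun n => slope (f n) x (y n)) atTop (nhds d) := by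
  have hs := hasDerivAt_iff_tendsto_slope.1 hd
  have hx := hlim.self_of_nhds
  have hslope : ∀ z, Tendsto (fun n => f n z) atTop (nhds (g z)) →
      Tendsto (fun n => slope (f n) x z) atTop (nhds (slope g x z)) := fun z hz => by
    simp only [slope_def_field]
    exact (hz.sub hx).div_const _
  have hgood : ∀ᶠ z in nhdsWithin x {x}ᶜ,
      Tendsto (fun n => f n z) atTop (nhds (g z)) := hlim.filter_mono nhdsWithin_le_nhds
  refine tendsto_order.2 ⟨fun c hc => ?_, fun c hc => ?_⟩
  · have hev := (hgood.and (hs.eventually (lt_mem_nhds hc))).filter_mono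
      (nhdsWithin_mono x (fun z (hz : z ∈ Set.Iio x) => hz.ne))
    obtain ⟨z, ⟨hz1, hz2⟩, hz3⟩ := (hev.and self_mem_nhdsWithin).exists
    have hz3 : z < x := hz3
    filter_upwards [(hslope z hz1).eventually (lt_mem_nhds hz2), hyx] with n h1 h2
    refine h1.trans_le ((hf n).slope_mono (Set.mem_univ x) ⟨Set.mem_univ z, hz3.ne⟩
      ⟨Set.mem_univ _, h2.ne'⟩ (hz3.trans h2).le)
  · have hev := (hgood.and (hs.eventually (gt_mem_nhds hc))).filter_mono
      (nhdsWithin_mono x (fun z (hz : z ∈ Set.Ioi x) => hz.ne'))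
    obtain ⟨z, ⟨hz1, hz2⟩, hz3⟩ := (hev.and self_mem_nhdsWithin).exists
    have hz3 : x < z := hz3
    filter_upwards [(hslope z hz1).eventually (gt_mem_nhds hz2), hyx,
      hy.eventually (gt_mem_nhds hz3)] with n h1 h2 h3
    exact ((hf n).slope_mono (Set.mem_univ x) ⟨Set.mem_univ _, h2.ne'⟩
      ⟨Set.mem_univ z, hz3.ne'⟩ h3.le).trans_lt h1

/-- If `α_M(β) → α(β)` for `β` in an open interval `I ⊆ (0,∞)` and `α` is
differentiable at `β₀ ∈ I`, then for every `N ≥ 1` and `β' ∈ ℝ`,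
`lim_{M→∞} (1/N) E[ln ω_{β₀}(exp(−β'√(N/2) Ĥ))] = (β'²/(4β₀)) α'(β₀)`;
in particular the limit is a degree-two monomial in `β'` and does not depend on `N`. -/
theorem internal_energy_limit (I : Set ℝ) (hI : IsOpen I) (hIpos : I ⊆ Set.Ioi (0 : ℝ))
    (α : ℝ → ℝ)
    (hlim : ∀ β ∈ I, Tendsto (fun M : ℕ => quenchedPressure M β) atTop (nhds (α β)))
    (β₀ : ℝ) (hβ₀ : β₀ ∈ I) (d : ℝ) (hd : HasDerivAt α d β₀)
    (N : ℕ) (hN : 1 ≤ N) (β' : ℝ) :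
    Tendsto (fun M : ℕ =>
        (1 / (N : ℝ)) * ∫ J, Real.log
          ((∑ τ : Fin M → Bool, boltzW M β₀ J.1 τ *
              Real.exp (-(β' * Real.sqrt ((N : ℝ) / 2)) * Hhat M J.2 τ)) / ZSK M β₀ J.1)
        ∂(jointLaw M))
      atTop (nhds (β' ^ 2 / (4 * β₀) * d)) := by
  have hβpos : 0 < β₀ := hIpos hβ₀
  have hN0 : (0 : ℝ) < N := by exact_mod_cast hN
  set b : ℝ := β' * Real.sqrt ((N : ℝ) / 2) with hb
  have hb2 : b ^ 2 = β' ^ 2 * (N / 2) := by rw [hb, mul_pow, Real.sq_sqrt (by positivity)]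
  set y : ℕ → ℝ := fun M => Real.sqrt (β₀ ^ 2 + b ^ 2 / M) with hydef
  have hy : Tendsto y atTop (nhds β₀) := by
    have h0 : Tendsto (fun M : ℕ => b ^ 2 / (M : ℝ)) atTop (nhds 0) :=
      tendsto_const_div_atTop_nhds_zero_nat _
    have h := (h0.const_add (β₀ ^ 2)).sqrt
    rwa [add_zero, Real.sqrt_sq hβpos.le] at h
  have hval : ∀ M : ℕ, 1 ≤ M → ∫ J, Real.log
      ((∑ τ : Fin M → Bool, boltzW M β₀ J.1 τ * Real.exp (-b * Hhat M J.2 τ)) / ZSK M β₀ J.1)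
        ∂(jointLaw M) = M * (quenchedPressure M (y M) - quenchedPressure M β₀) := fun M hM => by
    rw [integral_log_gibbs_average M hM, abs_of_pos hβpos]
  by_cases hb0 : b = 0
  · have hβ' : β' ^ 2 = 0 := by
      have : β' ^ 2 * (N / 2 : ℝ) = 0 := by rw [← hb2, hb0]; ring
      exact (mul_eq_zero.1 this).resolve_right (by positivity)
    rw [hβ', zero_div, zero_mul]
    refine tendsto_const_nhds.congr' ?_
    filter_upwards [eventually_ge_atTop 1] with M hM
    rw [hval M hM]
    simp [hydef, hb0, Real.sqrt_sq hβpos.le]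
  have hlt : ∀ M : ℕ, 1 ≤ M → β₀ < y M := fun M hM => by
    have hM0 : (0 : ℝ) < M := by exact_mod_cast hM
    refine Real.lt_sqrt_of_sq_lt ?_
    have : 0 < b ^ 2 / M := by positivity
    linarith
  have hslope := tendsto_slope_of_convexOn convexOn_quenchedPressure
    (Filter.eventually_of_mem (hI.mem_nhds hβ₀) hlim) hd hy
    ((eventually_ge_atTop 1).mono hlt)
  have hcoef : Tendsto (fun M => b ^ 2 / N / (y M + β₀)) atTop (nhds (β' ^ 2 / (4 * β₀))) := by
    have h := (tendsto_const_nhds (x := b ^ 2 / (N : ℝ))).div (hy.add_const β₀) (by positivity)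
    have hval : b ^ 2 / (N : ℝ) / (β₀ + β₀) = β' ^ 2 / (4 * β₀) := by
      rw [hb2]
      field_simp
      ring
    rwa [hval] at h
  refine (hcoef.mul hslope).congr' ?_
  filter_upwards [eventually_ge_atTop 1] with M hM
  have hM0 : (0 : ℝ) < M := by exact_mod_cast hM
  have hyM := hlt M hM
  have hysq : (y M - β₀) * (y M + β₀) = b ^ 2 / M := by
    have : y M ^ 2 = β₀ ^ 2 + b ^ 2 / M := Real.sq_sqrt (by positivity)
    linear_combination this
  have hbM : b ^ 2 = M * ((y M - β₀) * (y M + β₀)) := by rw [hysq]; field_simp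
  have h1 : y M - β₀ ≠ 0 := (sub_pos.2 hyM).ne'
  have h2 : y M + β₀ ≠ 0 := by linarith
  rw [hval M hM, slope_def_field, hbM]
  field_simp
end
end

section
/- (Aizenman–Contucci identity from stochastic stability.) In the random Gibbs/Gaussian setup, suppose there are ε > 0 and a ∈ ℝ such that E[ln Σ_τ W_τ exp(λ H_τ)] = a λ² for all λ with |λ| < ε. Then a = (1 − ⟨C_{12}⟩)/2 and the Aizenman–Contucci relation ⟨C_{12}²⟩ − 4⟨C_{12}C_{13}⟩ + 3⟨C_{12}C_{34}⟩ = 0 holds. -/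
open MeasureTheory ProbabilityTheory

noncomputable section

lemma integral_pow_mul_exp_gaussianReal_succ {v : NNReal} {n : ℕ} {p p' : ℝ → ℝ}
    (hp : ∀ t, HasDerivAt p (p' t) t)
    (h : ∀ t, ∫ x, x ^ n * Real.exp (t * x) ∂gaussianReal 0 v
      = p t * Real.exp (v * t ^ 2 / 2)) (t : ℝ) :
    ∫ x, x ^ (n + 1) * Real.exp (t * x) ∂gaussianReal 0 v
      = (p' t + v * t * p t) * Real.exp (v * t ^ 2 / 2) := by
  have h₁ := hasDerivAt_integral_pow_mul_exp_real (X := id) (μ := gaussianReal 0 v) (t := t)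
    (by simp) n
  simp only [id] at h₁
  simp only [h] at h₁
  have h₂ : HasDerivAt (fun s : ℝ ↦ Real.exp (v * s ^ 2 / 2))
      (Real.exp (v * t ^ 2 / 2) * (v * t)) t := by
    convert! (((hasDerivAt_id t).pow 2).const_mul (v : ℝ)).div_const 2 |>.exp using 1
    simp
    ring
  rw [h₁.unique ((hp t).mul h₂)]
  ring

lemma integral_pow_four_gaussianReal (v : NNReal) :
    ∫ x, x ^ 4 ∂gaussianReal 0 v = 3 * (v : ℝ) ^ 2 := by
  have h₀ (t : ℝ) : ∫ x, x ^ 0 * Real.exp (t * x) ∂gaussianReal 0 v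
      = 1 * Real.exp (v * t ^ 2 / 2) := by
    simpa [mgf] using congrFun (mgf_id_gaussianReal (μ := 0) (v := v)) t
  have h₁ := integral_pow_mul_exp_gaussianReal_succ (fun t ↦ hasDerivAt_const t (1 : ℝ)) h₀
  have h₂ := integral_pow_mul_exp_gaussianReal_succ (p' := fun _ ↦ (v : ℝ))
    (fun t ↦ by convert! (hasDerivAt_id t).const_mul (v : ℝ) using 1 <;> simp) h₁
  have h₃ := integral_pow_mul_exp_gaussianReal_succ (p' := fun t ↦ 2 * (v : ℝ) ^ 2 * t)
    (fun t ↦ by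
      convert! (((hasDerivAt_id t).pow 2).const_mul ((v : ℝ) ^ 2)).const_add (v : ℝ) using 1
      · ext s; simp; ring
      · simp; ring) h₂
  have h₄ := integral_pow_mul_exp_gaussianReal_succ
    (p' := fun t ↦ 3 * (v : ℝ) ^ 2 + 3 * (v : ℝ) ^ 3 * t ^ 2)
    (fun t ↦ by
      convert! ((hasDerivAt_id t).const_mul (3 * (v : ℝ) ^ 2)).add
        (((hasDerivAt_id t).pow 3).const_mul ((v : ℝ) ^ 3)) using 1
      · ext s; simp; ring
      · simp; ring) h₃ 0
  simpa using h₄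

lemma integral_sq_gaussianReal (v : NNReal) :
    ∫ x, x ^ 2 ∂gaussianReal 0 v = (v : ℝ) := by
  have h := variance_fun_id_gaussianReal (μ := 0) (v := v)
  rw [variance_eq_integral aemeasurable_id', integral_id_gaussianReal] at h
  simpa only [sub_zero] using h

lemma abs_le_mul_abs_pow_of_hasDerivAt {g g' : ℝ → ℝ} {K : ℝ} {n : ℕ}
    (hg : ∀ x, HasDerivAt g (g' x) x) (h₀ : g 0 = 0)
    (hb : ∀ x, |g' x| ≤ K * |x| ^ n) (x : ℝ) : |g x| ≤ K * |x| ^ (n + 1) := by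
  have hK : 0 ≤ K := by simpa using (abs_nonneg _).trans (hb 1)
  have := (convex_segment (0 : ℝ) x).norm_image_sub_le_of_norm_hasDerivWithin_le
    (C := K * |x| ^ n) (fun y _ ↦ (hg y).hasDerivWithinAt)
    (fun y hy ↦ (hb y).trans ?_) (left_mem_segment ℝ _ _) (right_mem_segment ℝ _ _)
  · simpa [h₀, pow_succ, mul_assoc] using this
  · have : |y| ≤ |x| := by
      have := (convex_closedBall (0 : ℝ) |x|).segment_subset (x := 0) (y := x)
        (by simp) (by simp) hy
      simpa using this
    gcongr

section Tilted

variable {S : Type*} [Fintype S] (w h : S → ℝ)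

/-- The unnormalised `k`-th moment of `h` under the weights `w` tilted by `exp (x * h)`. -/
def expMoment (k : ℕ) (x : ℝ) : ℝ := ∑ a, w a * h a ^ k * Real.exp (x * h a)

/-- The `k`-th moment of `h` under the normalised tilted weights. -/
def tiltedMoment (k : ℕ) (x : ℝ) : ℝ := expMoment w h k x / expMoment w h 0 x

lemma hasDerivAt_expMoment (k : ℕ) (x : ℝ) :
    HasDerivAt (expMoment w h k) (expMoment w h (k + 1) x) x := by
  unfold expMoment
  refine HasDerivAt.fun_sum fun a _ ↦ ?_
  convert! (((hasDerivAt_id x).mul_const (h a)).exp).const_mul (w a * h a ^ k) using 1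
  simp
  ring

variable {w h}

lemma expMoment_zero_pos (hw : ∀ a, 0 ≤ w a) (hs : ∑ a, w a = 1) (x : ℝ) :
    0 < expMoment w h 0 x := by
  obtain ⟨a, ha, hne⟩ := Finset.exists_ne_zero_of_sum_ne_zero (hs.trans_ne one_ne_zero)
  have hpos : 0 < w a := (hw a).lt_of_ne' hne
  refine Finset.sum_pos' (fun b _ ↦ ?_) ⟨a, ha, ?_⟩
  · simpa using mul_nonneg (hw b) (Real.exp_pos _).le
  · simpa using mul_pos hpos (Real.exp_pos _)

lemma hasDerivAt_tiltedMoment (hw : ∀ a, 0 ≤ w a) (hs : ∑ a, w a = 1) (k : ℕ) (x : ℝ) :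
    HasDerivAt (tiltedMoment w h k)
      (tiltedMoment w h (k + 1) x - tiltedMoment w h k x * tiltedMoment w h 1 x) x := by
  have hp := (expMoment_zero_pos (h := h) hw hs x).ne'
  convert! (hasDerivAt_expMoment w h k x).div (hasDerivAt_expMoment w h 0 x) hp using 1
  unfold tiltedMoment
  field_simp

lemma abs_tiltedMoment_le (hw : ∀ a, 0 ≤ w a) (hs : ∑ a, w a = 1) {M : ℝ}
    (hM : ∀ a, |h a| ≤ M) (k : ℕ) (x : ℝ) : |tiltedMoment w h k x| ≤ M ^ k := by
  have hp := expMoment_zero_pos (h := h) hw hs x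
  rw [tiltedMoment, abs_div, abs_of_pos hp, div_le_iff₀ hp, expMoment, expMoment, Finset.mul_sum]
  refine (Finset.abs_sum_le_sum_abs _ _).trans (Finset.sum_le_sum fun a _ ↦ ?_)
  have : |h a| ^ k ≤ M ^ k := by gcongr; exact hM a
  rw [abs_mul, abs_mul, abs_pow, abs_of_nonneg (hw a), Real.abs_exp]
  have := mul_le_mul_of_nonneg_left this (mul_nonneg (hw a) (Real.exp_pos (x * h a)).le)
  linarith

lemma tiltedMoment_zero (hs : ∑ a, w a = 1) (k : ℕ) :
    tiltedMoment w h k 0 = ∑ a, w a * h a ^ k := by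
  simp [tiltedMoment, expMoment, hs]

/-- Fourth-order Taylor expansion of `log ∑ a, w a * exp (x * h a)` at `0`, with the cumulants of
`h` under `w` as coefficients. -/
lemma abs_log_sum_exp_sub_le (hw : ∀ a, 0 ≤ w a) (hs : ∑ a, w a = 1) {M : ℝ}
    (hM : ∀ a, |h a| ≤ M) (m : ℕ → ℝ) (hm : ∀ k, m k = ∑ a, w a * h a ^ k) (x : ℝ) :
    |Real.log (∑ a, w a * Real.exp (x * h a)) - (m 1 * x + (m 2 - m 1 ^ 2) / 2 * x ^ 2
      + (m 3 - 3 * (m 2 * m 1) + 2 * m 1 ^ 3) / 6 * x ^ 3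
      + (m 4 - 4 * (m 3 * m 1) - 3 * m 2 ^ 2 + 12 * (m 2 * m 1 ^ 2) - 6 * m 1 ^ 4) / 24 * x ^ 4)|
      ≤ 150 * M ^ 5 * |x| ^ 5 := by
  have hM₀ : 0 ≤ M := by
    obtain ⟨a⟩ : Nonempty S := by
      by_contra hS
      rw [not_nonempty_iff] at hS
      simp at hs
    exact (abs_nonneg _).trans (hM a)
  set r := tiltedMoment w h with hr
  have hr₀ (k : ℕ) : r k 0 = m k := by rw [hm]; exact tiltedMoment_zero hs k
  have d (k : ℕ) (y : ℝ) : HasDerivAt (r k) (r (k + 1) y - r k y * r 1 y) y :=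
    hasDerivAt_tiltedMoment hw hs k y
  have b (k : ℕ) (y : ℝ) : |r k y| ≤ M ^ k := abs_tiltedMoment_le hw hs hM k y
  have dp (n : ℕ) (c y : ℝ) : HasDerivAt (fun z : ℝ ↦ c * z ^ (n + 1)) (c * ((n + 1) * y ^ n)) y := by
    simpa using (hasDerivAt_pow (n + 1) y).const_mul c
  set c₁ := m 1
  set c₂ := m 2 - m 1 ^ 2
  set c₃ := m 3 - 3 * (m 2 * m 1) + 2 * m 1 ^ 3
  set c₄ := m 4 - 4 * (m 3 * m 1) - 3 * m 2 ^ 2 + 12 * (m 2 * m 1 ^ 2) - 6 * m 1 ^ 4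
  have e₅ (y : ℝ) : |r 5 y - 5 * (r 4 y * r 1 y) - 10 * (r 3 y * r 2 y)
      + 20 * (r 3 y * r 1 y ^ 2) + 30 * (r 2 y ^ 2 * r 1 y) - 60 * (r 2 y * r 1 y ^ 3)
      + 24 * r 1 y ^ 5| ≤ 150 * M ^ 5 * |y| ^ 0 := by
    have b₁ := b 1 y
    have b₂ := b 2 y
    have b₃ := b 3 y
    have b₄ := b 4 y
    have b₅ := b 5 y
    have t₁ : |r 4 y * r 1 y| ≤ M ^ 4 * M ^ 1 := by rw [abs_mul]; gcongr
    have t₂ : |r 3 y * r 2 y| ≤ M ^ 3 * M ^ 2 := by rw [abs_mul]; gcongr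
    have t₃ : |r 3 y * r 1 y ^ 2| ≤ M ^ 3 * (M ^ 1) ^ 2 := by rw [abs_mul, abs_pow]; gcongr
    have t₄ : |r 2 y ^ 2 * r 1 y| ≤ (M ^ 2) ^ 2 * M ^ 1 := by rw [abs_mul, abs_pow]; gcongr
    have t₅ : |r 2 y * r 1 y ^ 3| ≤ M ^ 2 * (M ^ 1) ^ 3 := by rw [abs_mul, abs_pow]; gcongr
    have t₆ : |r 1 y ^ 5| ≤ (M ^ 1) ^ 5 := by rw [abs_pow]; gcongr
    ring_nf at t₁ t₂ t₃ t₄ t₅ t₆ b₅ ⊢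
    rw [abs_le] at *
    constructor <;> linarith
  have e₄ (y : ℝ) : |(r 4 y - 4 * (r 3 y * r 1 y) - 3 * r 2 y ^ 2 + 12 * (r 2 y * r 1 y ^ 2)
      - 6 * r 1 y ^ 4) - c₄| ≤ 150 * M ^ 5 * |y| ^ (0 + 1) := by
    refine abs_le_mul_abs_pow_of_hasDerivAt (g := fun y ↦ (r 4 y - 4 * (r 3 y * r 1 y)
      - 3 * r 2 y ^ 2 + 12 * (r 2 y * r 1 y ^ 2) - 6 * r 1 y ^ 4) - c₄) (fun y ↦ ?_) ?_ e₅ y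
    · convert! ((((((d 4 y).sub (((d 3 y).mul (d 1 y)).const_mul 4)).sub
        (((d 2 y).pow 2).const_mul 3)).add (((d 2 y).mul ((d 1 y).pow 2)).const_mul 12)).sub
        (((d 1 y).pow 4).const_mul 6)).sub_const c₄) using 1
      simp
      ring
    · simp only [hr₀]; ring
  have e₃ (y : ℝ) : |(r 3 y - 3 * (r 2 y * r 1 y) + 2 * r 1 y ^ 3) - (c₃ + c₄ * y ^ (0 + 1))|
      ≤ 150 * M ^ 5 * |y| ^ (1 + 1) := by
    refine abs_le_mul_abs_pow_of_hasDerivAt (g := fun y ↦ (r 3 y - 3 * (r 2 y * r 1 y)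
      + 2 * r 1 y ^ 3) - (c₃ + c₄ * y ^ (0 + 1))) (fun y ↦ ?_) ?_ e₄ y
    · convert! (((d 3 y).sub (((d 2 y).mul (d 1 y)).const_mul 3)).add
        (((d 1 y).pow 3).const_mul 2)).sub ((dp 0 c₄ y).const_add c₃) using 1
      simp
      ring
    · simp only [hr₀]; ring
  have e₂ (y : ℝ) : |(r 2 y - r 1 y ^ 2) - (c₂ + (c₃ * y ^ (0 + 1) + c₄ / 2 * y ^ (1 + 1)))|
      ≤ 150 * M ^ 5 * |y| ^ (2 + 1) := by
    refine abs_le_mul_abs_pow_of_hasDerivAt (g := fun y ↦ (r 2 y - r 1 y ^ 2)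
      - (c₂ + (c₃ * y ^ (0 + 1) + c₄ / 2 * y ^ (1 + 1)))) (fun y ↦ ?_) ?_ e₃ y
    · convert! ((d 2 y).sub ((d 1 y).pow 2)).sub
        (((dp 0 c₃ y).add (dp 1 (c₄ / 2) y)).const_add c₂) using 1
      simp
      ring
    · simp only [hr₀]; ring
  have e₁ (y : ℝ) : |r 1 y - (c₁ + (c₂ * y ^ (0 + 1) + c₃ / 2 * y ^ (1 + 1)
      + c₄ / 6 * y ^ (2 + 1)))| ≤ 150 * M ^ 5 * |y| ^ (3 + 1) := by
    refine abs_le_mul_abs_pow_of_hasDerivAt (g := fun y ↦ r 1 y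
      - (c₁ + (c₂ * y ^ (0 + 1) + c₃ / 2 * y ^ (1 + 1) + c₄ / 6 * y ^ (2 + 1))))
      (fun y ↦ ?_) ?_ e₂ y
    · convert! (d 1 y).sub ((((dp 0 c₂ y).add (dp 1 (c₃ / 2) y)).add
        (dp 2 (c₄ / 6) y)).const_add c₁) using 1
      simp
      ring
    · simp only [hr₀]; ring
  have e₀ := abs_le_mul_abs_pow_of_hasDerivAt (g := fun y ↦ Real.log (expMoment w h 0 y)
      - (c₁ * y ^ (0 + 1) + c₂ / 2 * y ^ (1 + 1) + c₃ / 6 * y ^ (2 + 1) + c₄ / 24 * y ^ (3 + 1)))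
      (fun y ↦ ?_) ?_ e₁ x
  · simpa [expMoment] using e₀
  · convert! ((hasDerivAt_expMoment w h 0 y).log (expMoment_zero_pos hw hs y).ne').sub
      ((((dp 0 c₁ y).add (dp 1 (c₂ / 2) y)).add (dp 2 (c₃ / 6) y)).add (dp 3 (c₄ / 24) y)) using 1
    simp [hr, tiltedMoment]
    ring
  · simp [expMoment, hs]

lemma abs_log_sum_exp_le (hw : ∀ a, 0 ≤ w a) (hs : ∑ a, w a = 1) {M : ℝ}
    (hM : ∀ a, |h a| ≤ M) (x : ℝ) :
    |Real.log (∑ a, w a * Real.exp (x * h a))| ≤ M * |x| := by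
  have := abs_le_mul_abs_pow_of_hasDerivAt (n := 0)
    (fun y ↦ (hasDerivAt_expMoment w h 0 y).log (expMoment_zero_pos hw hs y).ne')
    (by simp [expMoment, hs])
    (fun y ↦ by simpa [tiltedMoment] using abs_tiltedMoment_le hw hs hM 1 y) x
  simpa [expMoment] using this

/-- The symmetrised form of `abs_log_sum_exp_sub_le`, in which the odd cumulants cancel. -/
lemma abs_log_sum_exp_add_log_sum_exp_neg_sub_le (hw : ∀ a, 0 ≤ w a) (hs : ∑ a, w a = 1) {M : ℝ}
    (hM : ∀ a, |h a| ≤ M) (m : ℕ → ℝ) (hm : ∀ k, m k = ∑ a, w a * h a ^ k) (x : ℝ) :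
    |Real.log (∑ a, w a * Real.exp (x * h a)) + Real.log (∑ a, w a * Real.exp (-x * h a))
      - ((m 2 - m 1 ^ 2) * x ^ 2
      + (m 4 - 4 * (m 3 * m 1) - 3 * m 2 ^ 2 + 12 * (m 2 * m 1 ^ 2) - 6 * m 1 ^ 4) / 12 * x ^ 4)|
      ≤ 300 * M ^ 5 * |x| ^ 5 := by
  have h₁ := abs_log_sum_exp_sub_le hw hs hM m hm x
  have h₂ := abs_log_sum_exp_sub_le hw hs hM m hm (-x)
  rw [abs_neg] at h₂
  rw [abs_le] at h₁ h₂ ⊢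
  constructor <;> linarith

end Tilted

/-- An even quartic polynomial with no constant term that is `O(x ^ 5)` at `0⁺` vanishes. -/
lemma coeff_eq_zero_of_abs_le {q t K ε : ℝ} (hε : 0 < ε)
    (hb : ∀ x, 0 < x → x < ε → |q * x ^ 2 + t * x ^ 4| ≤ K * x ^ 5) :
    q = 0 ∧ t = 0 := by
  have key (c : ℝ) (n : ℕ) (L : ℝ) (h : ∀ x, 0 < x → x < ε → |c * x ^ n| ≤ L * x ^ (n + 1)) :
      c = 0 := by
    by_contra hc
    have hc' := abs_pos.2 hc
    have hL : 0 < |L| + 1 := by positivity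
    set x := min (ε / 2) (|c| / (2 * (|L| + 1)))
    have hx : 0 < x := by positivity
    have h₁ := h x hx ((min_le_left _ _).trans_lt (by linarith))
    rw [abs_mul, abs_of_pos (pow_pos hx n), pow_succ', ← mul_assoc,
      mul_le_mul_iff_left₀ (pow_pos hx n)] at h₁
    have h₂ : x * (2 * (|L| + 1)) ≤ |c| := (le_div_iff₀ (by positivity)).1 (min_le_right _ _)
    nlinarith [le_abs_self L]
  have hq : q = 0 := by
    refine key q 2 (|K| * ε ^ 2 + |t| * ε) fun x hx hxε ↦ ?_
    have h₁ : |q * x ^ 2| ≤ K * x ^ 5 + |t| * x ^ 4 := by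
      have := abs_sub (q * x ^ 2 + t * x ^ 4) (t * x ^ 4)
      rw [add_sub_cancel_right, abs_mul t, abs_of_pos (pow_pos hx 4)] at this
      linarith [hb x hx hxε]
    have h₂ : K * x ^ 5 ≤ |K| * (ε ^ 2 * x ^ 3) := by
      have : x ^ 5 ≤ ε ^ 2 * x ^ 3 := by
        rw [show x ^ 5 = x ^ 2 * x ^ 3 by ring]; gcongr
      exact (mul_le_mul_of_nonneg_right (le_abs_self K) (by positivity)).trans (by gcongr)
    have h₃ : |t| * x ^ 4 ≤ |t| * (ε * x ^ 3) := by
      rw [show x ^ 4 = x * x ^ 3 by ring]; gcongr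
    linear_combination h₁ + h₂ + h₃
  refine ⟨hq, key t 4 K fun x hx hxε ↦ ?_⟩
  simpa [hq] using hb x hx hxε

section Gaussian

variable {Ω S : Type*} [MeasurableSpace Ω] {P : Measure Ω} [Fintype S]

/-- `H` is a centered Gaussian family with symmetric positive semidefinite covariance matrix `C`,
expressed through the laws of its linear combinations. -/
structure IsCenteredGaussianFamily (P : Measure Ω) (C : S → S → ℝ) (H : S → Ω → ℝ) : Prop where
  symm : ∀ a b, C a b = C b a
  nonneg : ∀ v : S → ℝ, 0 ≤ ∑ a : S, ∑ b : S, v a * v b * C a b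
  measurable : ∀ a, Measurable (H a)
  map_eq : ∀ v : S → ℝ, Measure.map (fun ω ↦ ∑ a : S, v a * H a ω) P =
    gaussianReal 0 (Real.toNNReal (∑ a : S, ∑ b : S, v a * v b * C a b))

namespace IsCenteredGaussianFamily

variable {C : S → S → ℝ} {H : S → Ω → ℝ}

lemma memLp_sum (hH : IsCenteredGaussianFamily P C H) (v : S → ℝ) (p : NNReal) :
    MemLp (fun ω ↦ ∑ a, v a * H a ω) p P := by
  have hm : Measurable fun ω ↦ ∑ a, v a * H a ω :=
    Finset.measurable_fun_sum _ fun a _ ↦ (hH.measurable a).const_mul _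
  refine MemLp.comp_of_map (g := id) (f := fun ω ↦ ∑ a, v a * H a ω) ?_ hm.aemeasurable
  rw [hH.map_eq]
  exact memLp_id_gaussianReal p

lemma memLp (hH : IsCenteredGaussianFamily P C H) (a : S) (p : NNReal) : MemLp (H a) p P := by
  classical
  simpa [Pi.single_apply] using hH.memLp_sum (Pi.single a 1) p

lemma integral_sum_pow_two (hH : IsCenteredGaussianFamily P C H) (v : S → ℝ) :
    ∫ ω, (∑ a, v a * H a ω) ^ 2 ∂P = ∑ a, ∑ b, v a * v b * C a b := by
  have hm : Measurable fun ω ↦ ∑ a, v a * H a ω :=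
    Finset.measurable_fun_sum _ fun a _ ↦ (hH.measurable a).const_mul _
  rw [← integral_map (φ := fun ω ↦ ∑ a, v a * H a ω) (f := fun x : ℝ ↦ x ^ 2) hm.aemeasurable
    (by fun_prop), hH.map_eq, integral_sq_gaussianReal, Real.coe_toNNReal _ (hH.nonneg v)]

lemma integral_sum_pow_four (hH : IsCenteredGaussianFamily P C H) (v : S → ℝ) :
    ∫ ω, (∑ a, v a * H a ω) ^ 4 ∂P = 3 * (∑ a, ∑ b, v a * v b * C a b) ^ 2 := by
  have hm : Measurable fun ω ↦ ∑ a, v a * H a ω :=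
    Finset.measurable_fun_sum _ fun a _ ↦ (hH.measurable a).const_mul _
  rw [← integral_map (φ := fun ω ↦ ∑ a, v a * H a ω) (f := fun x : ℝ ↦ x ^ 4) hm.aemeasurable
    (by fun_prop), hH.map_eq, integral_pow_four_gaussianReal, Real.coe_toNNReal _ (hH.nonneg v)]

lemma integrable_sum_pow (hH : IsCenteredGaussianFamily P C H) (v : S → ℝ) {n : ℕ}
    (hn : Even n) (hn₀ : n ≠ 0) : Integrable (fun ω ↦ (∑ a, v a * H a ω) ^ n) P := by
  simpa [hn.pow_abs] using MemLp.integrable_norm_pow (p := n) (hH.memLp_sum v n) hn₀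

lemma integrable_mul_and_integral_mul (hH : IsCenteredGaussianFamily P C H) (a b : S) :
    Integrable (fun ω ↦ H a ω * H b ω) P ∧ ∫ ω, H a ω * H b ω ∂P = C a b := by
  classical
  let v (s : ℝ) : S → ℝ := Pi.single a 1 + s • Pi.single b 1
  have hv (s : ℝ) (ω : Ω) : ∑ x, v s x * H x ω = H a ω + s * H b ω := by
    simp [v, add_mul, Finset.sum_add_distrib, Pi.single_apply]
  have hq (s : ℝ) : ∑ x, ∑ y, v s x * v s y * C x y = C a a + 2 * s * C a b + s ^ 2 * C b b := by
    simp [v, add_mul, mul_add, Finset.sum_add_distrib, Pi.single_apply, hH.symm b a]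
    ring
  have hi (s : ℝ) := hH.integrable_sum_pow (v s) even_two two_ne_zero
  have he (s : ℝ) := hH.integral_sum_pow_two (v s)
  simp only [hv, hq] at hi he
  have key (ω : Ω) : H a ω * H b ω
      = ((H a ω + 1 * H b ω) ^ 2 - (H a ω + -1 * H b ω) ^ 2) / 4 := by ring
  simp only [key]
  refine ⟨((hi 1).sub (hi (-1))).div_const 4, ?_⟩
  rw [integral_div, integral_sub (hi 1) (hi (-1)), he, he]
  ring

/-- Wick's formula for fourth-order moments. -/
lemma integrable_mul_and_integral_mul_four (hH : IsCenteredGaussianFamily P C H) (a b c d : S) :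
    Integrable (fun ω ↦ H a ω * H b ω * H c ω * H d ω) P ∧
    ∫ ω, H a ω * H b ω * H c ω * H d ω ∂P = C a b * C c d + C a c * C b d + C a d * C b c := by
  classical
  let v (s t u : ℝ) : S → ℝ :=
    Pi.single a 1 + s • Pi.single b 1 + t • Pi.single c 1 + u • Pi.single d 1
  have hv (s t u : ℝ) (ω : Ω) :
      ∑ x, v s t u x * H x ω = H a ω + s * H b ω + t * H c ω + u * H d ω := by
    simp [v, add_mul, Finset.sum_add_distrib, Pi.single_apply]
  have hq (s t u : ℝ) : ∑ x, ∑ y, v s t u x * v s t u y * C x y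
      = C a a + s ^ 2 * C b b + t ^ 2 * C c c + u ^ 2 * C d d
        + 2 * (s * C a b + t * C a c + u * C a d + s * t * C b c + s * u * C b d
          + t * u * C c d) := by
    simp [v, add_mul, mul_add, Finset.sum_add_distrib, Pi.single_apply, hH.symm b a, hH.symm c a,
      hH.symm d a, hH.symm c b, hH.symm d b, hH.symm d c]
    ring
  have hi (s t u : ℝ) := hH.integrable_sum_pow (v s t u) (n := 4) (by decide) (by decide)
  have he (s t u : ℝ) := hH.integral_sum_pow_four (v s t u)
  simp only [hv, hq] at hi he
  let σ (i : Bool) : ℝ := if i then 1 else -1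
  have key (ω : Ω) : H a ω * H b ω * H c ω * H d ω = ∑ i, ∑ j, ∑ k, σ i * σ j * σ k / 192 *
      (H a ω + σ i * H b ω + σ j * H c ω + σ k * H d ω) ^ 4 := by
    simp [σ]
    ring
  have hi' (i j k : Bool) := (hi (σ i) (σ j) (σ k)).const_mul (σ i * σ j * σ k / 192)
  simp only [key]
  refine ⟨integrable_finsetSum _ fun i _ ↦ integrable_finsetSum _ fun j _ ↦
    integrable_finsetSum _ fun k _ ↦ hi' i j k, ?_⟩
  rw [integral_finsetSum _ fun i _ ↦ integrable_finsetSum _ fun j _ ↦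
    integrable_finsetSum _ fun k _ ↦ hi' i j k]
  simp_rw [integral_finsetSum _ fun j _ ↦ integrable_finsetSum _ fun k _ ↦ hi' _ j k,
    integral_finsetSum _ fun k _ ↦ hi' _ _ k, integral_const_mul, he]
  simp [σ]
  ring

lemma integrable_sum_abs_pow (hH : IsCenteredGaussianFamily P C H) {n : ℕ} (hn : n ≠ 0) :
    Integrable (fun ω ↦ (∑ a, |H a ω|) ^ n) P := by
  have : MemLp (fun ω ↦ ∑ a, |H a ω|) (n : NNReal) P :=
    memLp_finsetSum _ fun a _ ↦ (hH.memLp a n).abs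
  have := MemLp.integrable_norm_pow (p := n) (by simpa using this) hn
  refine this.congr (.of_forall fun ω ↦ ?_)
  simp [abs_of_nonneg (Finset.sum_nonneg fun a (_ : a ∈ Finset.univ) ↦ abs_nonneg (H a ω))]

end IsCenteredGaussianFamily

end Gaussian

/-- Averaging out the second of two independent variables in a finite sum of products. -/
lemma IndepFun.integrable_and_integral_sum_comp_mul_comp {Ω X Y ι : Type*} [MeasurableSpace Ω]
    [MeasurableSpace X] [MeasurableSpace Y] [Fintype ι] {P : Measure Ω}
    {U : Ω → X} {V : Ω → Y} (hUV : IndepFun U V P) {F : ι → X → ℝ} {G : ι → Y → ℝ} {c : ι → ℝ}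
    (hF : ∀ i, Measurable (F i)) (hG : ∀ i, Measurable (G i))
    (hFi : ∀ i, Integrable (fun ω ↦ F i (U ω)) P)
    (hGi : ∀ i, Integrable (fun ω ↦ G i (V ω)) P ∧ ∫ ω, G i (V ω) ∂P = c i) :
    Integrable (fun ω ↦ ∑ i, F i (U ω) * G i (V ω)) P ∧
    ∫ ω, ∑ i, F i (U ω) * G i (V ω) ∂P = ∫ ω, ∑ i, F i (U ω) * c i ∂P := by
  have hind (i : ι) : IndepFun (fun ω ↦ F i (U ω)) (fun ω ↦ G i (V ω)) P :=
    hUV.comp (hF i) (hG i)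
  have hint (i : ι) : Integrable (fun ω ↦ F i (U ω) * G i (V ω)) P :=
    (hind i).integrable_mul (hFi i) (hGi i).1
  refine ⟨integrable_finsetSum _ fun i _ ↦ hint i, ?_⟩
  rw [integral_finsetSum _ fun i _ ↦ hint i,
    integral_finsetSum _ fun i _ ↦ (hFi i).mul_const (c i)]
  refine Finset.sum_congr rfl fun i _ ↦ ?_
  rw [integral_mul_const, ← (hGi i).2]
  exact (hind i).integral_mul_eq_mul_integral (hFi i).1 (hGi i).1.1

lemma sum_mul_sum_eq_sum_prod {α β : Type*} [Fintype α] [Fintype β] (f : α → ℝ) (g : β → ℝ) :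
    (∑ a, f a) * ∑ b, g b = ∑ p : α × β, f p.1 * g p.2 := by
  rw [Finset.sum_mul_sum, Fintype.sum_prod_type]

section Cumulants

variable {Ω S : Type*} [MeasurableSpace Ω] {P : Measure Ω} [Fintype S]
  {W : S → Ω → ℝ}

lemma ae_mem_Icc_of_weights (hW : ∀ᵐ ω ∂P, (∀ a, 0 ≤ W a ω) ∧ ∑ a, W a ω = 1) :
    ∀ᵐ ω ∂P, ∀ a, W a ω ∈ Set.Icc (0 : ℝ) 1 := by
  filter_upwards [hW] with ω hω a
  exact ⟨hω.1 a, hω.2 ▸ Finset.single_le_sum (f := fun a ↦ W a ω) (fun b _ ↦ hω.1 b)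
    (Finset.mem_univ a)⟩

lemma integrable_of_ae_mem_Icc [IsFiniteMeasure P] {f : Ω → ℝ} (hf : Measurable f)
    (h : ∀ᵐ ω ∂P, f ω ∈ Set.Icc (0 : ℝ) 1) : Integrable f P :=
  .of_bound hf.aestronglyMeasurable 1 <| h.mono fun ω hω ↦ by
    rw [Real.norm_eq_abs, abs_of_nonneg hω.1]
    exact hω.2

/-- The expected second and fourth cumulants of a Gaussian family under independent random
weights. -/
lemma integrable_and_integral_cumulants [IsProbabilityMeasure P] {C : S → S → ℝ} {H : S → Ω → ℝ}
    (hH : IsCenteredGaussianFamily P C H) (hdiag : ∀ a, C a a = 1)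
    (hWmeas : ∀ a, Measurable (W a))
    (hW : ∀ᵐ ω ∂P, (∀ a, 0 ≤ W a ω) ∧ ∑ a, W a ω = 1)
    (hindep : IndepFun (fun ω a ↦ W a ω) (fun ω a ↦ H a ω) P)
    (m : ℕ → Ω → ℝ) (hm : ∀ k ω, m k ω = ∑ a, W a ω * H a ω ^ k) :
    (Integrable (fun ω ↦ m 2 ω - m 1 ω ^ 2) P ∧
      ∫ ω, m 2 ω - m 1 ω ^ 2 ∂P = 1 - ∫ ω, ∑ a, ∑ b, W a ω * W b ω * C a b ∂P) ∧
    (Integrable (fun ω ↦ m 4 ω - 4 * (m 3 ω * m 1 ω) - 3 * m 2 ω ^ 2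
        + 12 * (m 2 ω * m 1 ω ^ 2) - 6 * m 1 ω ^ 4) P ∧
      ∫ ω, m 4 ω - 4 * (m 3 ω * m 1 ω) - 3 * m 2 ω ^ 2
        + 12 * (m 2 ω * m 1 ω ^ 2) - 6 * m 1 ω ^ 4 ∂P
      = -6 * ((∫ ω, ∑ a, ∑ b, W a ω * W b ω * C a b ^ 2 ∂P)
        - 4 * (∫ ω, ∑ a, ∑ b, ∑ c, W a ω * W b ω * W c ω * (C a b * C a c) ∂P)
        + 3 * (∫ ω, ∑ a, ∑ b, ∑ c, ∑ d,
          W a ω * W b ω * W c ω * W d ω * (C a b * C c d) ∂P))) := by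
  have hI := ae_mem_Icc_of_weights hW
  have i₁ (a : S) : Integrable (fun ω ↦ W a ω) P :=
    integrable_of_ae_mem_Icc (by fun_prop) (hI.mono fun ω h ↦ h a)
  have i₂ (a b : S) : Integrable (fun ω ↦ W a ω * W b ω) P :=
    integrable_of_ae_mem_Icc (by fun_prop)
      (hI.mono fun ω h ↦ unitInterval.mul_mem (h a) (h b))
  have i₃ (a b c : S) : Integrable (fun ω ↦ W a ω * W b ω * W c ω) P :=
    integrable_of_ae_mem_Icc (by fun_prop)
      (hI.mono fun ω h ↦ unitInterval.mul_mem (unitInterval.mul_mem (h a) (h b)) (h c))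
  have i₄ (a b c d : S) : Integrable (fun ω ↦ W a ω * W b ω * W c ω * W d ω) P :=
    integrable_of_ae_mem_Icc (by fun_prop)
      (hI.mono fun ω h ↦ unitInterval.mul_mem
        (unitInterval.mul_mem (unitInterval.mul_mem (h a) (h b)) (h c)) (h d))
  set c₂ : Ω → ℝ := fun ω ↦ ∑ a, ∑ b, W a ω * W b ω * C a b with hc₂
  set q : Ω → ℝ := fun ω ↦ ∑ a, ∑ b, W a ω * W b ω * C a b ^ 2 with hq
  set t : Ω → ℝ := fun ω ↦ ∑ a, ∑ b, ∑ c, W a ω * W b ω * W c ω * (C a b * C a c) with ht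
  set u : Ω → ℝ := fun ω ↦ ∑ a, ∑ b, ∑ c, ∑ d,
    W a ω * W b ω * W c ω * W d ω * (C a b * C c d) with hu
  have hc₂i : Integrable c₂ P := integrable_finsetSum _ fun a _ ↦ integrable_finsetSum _ fun b _ ↦
    (i₂ a b).mul_const _
  have hqi : Integrable q P := integrable_finsetSum _ fun a _ ↦ integrable_finsetSum _ fun b _ ↦
    (i₂ a b).mul_const _
  have hti : Integrable t P := integrable_finsetSum _ fun a _ ↦ integrable_finsetSum _ fun b _ ↦
    integrable_finsetSum _ fun c _ ↦ (i₃ a b c).mul_const _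
  have j₂ : Integrable (m 2) P ∧ ∫ ω, m 2 ω ∂P = 1 := by
    have := IndepFun.integrable_and_integral_sum_comp_mul_comp hindep (ι := S)
      (F := fun a w ↦ w a) (G := fun a h ↦ h a * h a) (c := fun a ↦ C a a)
      (fun _ ↦ by fun_prop) (fun _ ↦ by fun_prop) i₁
      (fun a ↦ hH.integrable_mul_and_integral_mul a a)
    have e : (fun ω ↦ ∑ a, W a ω * (H a ω * H a ω)) = m 2 := by
      ext ω; simp only [hm, pow_two]
    have e' : (fun ω ↦ ∑ a, W a ω * C a a) =ᵐ[P] fun _ ↦ 1 := by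
      filter_upwards [hW] with ω hω
      simp [hdiag, hω.2]
    rw [e, integral_congr_ae e'] at this
    simpa using this
  have j₁₁ : Integrable (fun ω ↦ m 1 ω ^ 2) P ∧ ∫ ω, m 1 ω ^ 2 ∂P = ∫ ω, c₂ ω ∂P := by
    have := IndepFun.integrable_and_integral_sum_comp_mul_comp hindep (ι := S × S)
      (F := fun p w ↦ w p.1 * w p.2) (G := fun p h ↦ h p.1 * h p.2) (c := fun p ↦ C p.1 p.2)
      (fun _ ↦ by fun_prop) (fun _ ↦ by fun_prop) (fun p ↦ i₂ p.1 p.2)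
      (fun p ↦ hH.integrable_mul_and_integral_mul p.1 p.2)
    have e : (fun ω ↦ ∑ p : S × S, W p.1 ω * W p.2 ω * (H p.1 ω * H p.2 ω))
        = fun ω ↦ m 1 ω ^ 2 := by
      ext ω
      simp only [hm, pow_two, sum_mul_sum_eq_sum_prod]
      exact Finset.sum_congr rfl fun p _ ↦ by ring
    have e' : (fun ω ↦ ∑ p : S × S, W p.1 ω * W p.2 ω * C p.1 p.2) = c₂ := by
      ext ω; simp only [hc₂, Fintype.sum_prod_type]
    rwa [e, e'] at this
  have j₄ : Integrable (m 4) P ∧ ∫ ω, m 4 ω ∂P = 3 := by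
    have := IndepFun.integrable_and_integral_sum_comp_mul_comp hindep (ι := S)
      (F := fun a w ↦ w a) (G := fun a h ↦ h a * h a * h a * h a) (c := _)
      (fun _ ↦ by fun_prop) (fun _ ↦ by fun_prop) i₁
      (fun a ↦ hH.integrable_mul_and_integral_mul_four a a a a)
    have e : (fun ω ↦ ∑ a, W a ω * (H a ω * H a ω * H a ω * H a ω)) = m 4 := by
      ext ω
      rw [hm]
      exact Finset.sum_congr rfl fun p _ ↦ by ring
    have e' : (fun ω ↦ ∑ a, W a ω * (C a a * C a a + C a a * C a a + C a a * C a a))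
        =ᵐ[P] fun _ ↦ 3 := by
      filter_upwards [hW] with ω hω
      simp only [hdiag, ← Finset.sum_mul, hω.2]
      norm_num
    rw [e, integral_congr_ae e'] at this
    simpa using this
  have j₃₁ : Integrable (fun ω ↦ m 3 ω * m 1 ω) P ∧
      ∫ ω, m 3 ω * m 1 ω ∂P = 3 * ∫ ω, c₂ ω ∂P := by
    have := IndepFun.integrable_and_integral_sum_comp_mul_comp hindep (ι := S × S)
      (F := fun p w ↦ w p.1 * w p.2) (G := fun p h ↦ h p.1 * h p.1 * h p.1 * h p.2) (c := _)
      (fun _ ↦ by fun_prop) (fun _ ↦ by fun_prop) (fun p ↦ i₂ p.1 p.2)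
      (fun p ↦ hH.integrable_mul_and_integral_mul_four p.1 p.1 p.1 p.2)
    have e : (fun ω ↦ ∑ p : S × S, W p.1 ω * W p.2 ω * (H p.1 ω * H p.1 ω * H p.1 ω * H p.2 ω))
        = fun ω ↦ m 3 ω * m 1 ω := by
      ext ω
      simp only [hm, sum_mul_sum_eq_sum_prod]
      exact Finset.sum_congr rfl fun p _ ↦ by ring
    have e' : (fun ω ↦ ∑ p : S × S, W p.1 ω * W p.2 ω * (C p.1 p.1 * C p.1 p.2
        + C p.1 p.1 * C p.1 p.2 + C p.1 p.2 * C p.1 p.1)) = fun ω ↦ 3 * c₂ ω := by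
      ext ω
      simp only [hc₂, Fintype.sum_prod_type, hdiag, Finset.mul_sum]
      exact Finset.sum_congr rfl fun a _ ↦ Finset.sum_congr rfl fun b _ ↦ by ring
    rwa [e, e', integral_const_mul] at this
  have j₂₂ : Integrable (fun ω ↦ m 2 ω ^ 2) P ∧
      ∫ ω, m 2 ω ^ 2 ∂P = 1 + 2 * ∫ ω, q ω ∂P := by
    have := IndepFun.integrable_and_integral_sum_comp_mul_comp hindep (ι := S × S)
      (F := fun p w ↦ w p.1 * w p.2) (G := fun p h ↦ h p.1 * h p.1 * h p.2 * h p.2) (c := _)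
      (fun _ ↦ by fun_prop) (fun _ ↦ by fun_prop) (fun p ↦ i₂ p.1 p.2)
      (fun p ↦ hH.integrable_mul_and_integral_mul_four p.1 p.1 p.2 p.2)
    have e : (fun ω ↦ ∑ p : S × S, W p.1 ω * W p.2 ω * (H p.1 ω * H p.1 ω * H p.2 ω * H p.2 ω))
        = fun ω ↦ m 2 ω ^ 2 := by
      ext ω
      rw [sq]
      simp only [hm, sum_mul_sum_eq_sum_prod]
      exact Finset.sum_congr rfl fun p _ ↦ by ring
    have e' : (fun ω ↦ ∑ p : S × S, W p.1 ω * W p.2 ω * (C p.1 p.1 * C p.2 p.2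
        + C p.1 p.2 * C p.1 p.2 + C p.1 p.2 * C p.1 p.2)) =ᵐ[P] fun ω ↦ 1 + 2 * q ω := by
      filter_upwards [hW] with ω hω
      have : (1 : ℝ) = (∑ a, W a ω) * ∑ b, W b ω := by rw [hω.2, one_mul]
      rw [this, Finset.sum_mul_sum]
      simp only [hq, Fintype.sum_prod_type, hdiag, Finset.mul_sum, ← Finset.sum_add_distrib]
      exact Finset.sum_congr rfl fun a _ ↦ Finset.sum_congr rfl fun b _ ↦ by ring
    rw [e, integral_congr_ae e', integral_add (integrable_const _) (hqi.const_mul 2),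
      integral_const_mul] at this
    simpa using this
  have j₂₁₁ : Integrable (fun ω ↦ m 2 ω * m 1 ω ^ 2) P ∧
      ∫ ω, m 2 ω * m 1 ω ^ 2 ∂P = (∫ ω, c₂ ω ∂P) + 2 * ∫ ω, t ω ∂P := by
    have := IndepFun.integrable_and_integral_sum_comp_mul_comp hindep (ι := S × S × S)
      (F := fun p w ↦ w p.1 * w p.2.1 * w p.2.2)
      (G := fun p h ↦ h p.1 * h p.1 * h p.2.1 * h p.2.2) (c := _)
      (fun _ ↦ by fun_prop) (fun _ ↦ by fun_prop) (fun p ↦ i₃ p.1 p.2.1 p.2.2)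
      (fun p ↦ hH.integrable_mul_and_integral_mul_four p.1 p.1 p.2.1 p.2.2)
    have e : (fun ω ↦ ∑ p : S × S × S, W p.1 ω * W p.2.1 ω * W p.2.2 ω *
        (H p.1 ω * H p.1 ω * H p.2.1 ω * H p.2.2 ω)) = fun ω ↦ m 2 ω * m 1 ω ^ 2 := by
      ext ω
      rw [sq]
      simp only [hm, sum_mul_sum_eq_sum_prod]
      exact Finset.sum_congr rfl fun p _ ↦ by ring
    have e' : (fun ω ↦ ∑ p : S × S × S, W p.1 ω * W p.2.1 ω * W p.2.2 ω *
        (C p.1 p.1 * C p.2.1 p.2.2 + C p.1 p.2.1 * C p.1 p.2.2 + C p.1 p.2.2 * C p.1 p.2.1))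
        =ᵐ[P] fun ω ↦ c₂ ω + 2 * t ω := by
      filter_upwards [hW] with ω hω
      rw [← one_mul (c₂ ω), ← hω.2, Finset.sum_mul]
      simp only [hc₂, ht, Fintype.sum_prod_type, hdiag, Finset.mul_sum, ← Finset.sum_add_distrib]
      exact Finset.sum_congr rfl fun a _ ↦ Finset.sum_congr rfl fun b _ ↦
        Finset.sum_congr rfl fun c _ ↦ by ring
    rw [e, integral_congr_ae e', integral_add hc₂i (hti.const_mul 2), integral_const_mul] at this
    exact this
  have j₁₁₁₁ : Integrable (fun ω ↦ m 1 ω ^ 4) P ∧ ∫ ω, m 1 ω ^ 4 ∂P = 3 * ∫ ω, u ω ∂P := by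
    have := IndepFun.integrable_and_integral_sum_comp_mul_comp hindep (ι := S × S × S × S)
      (F := fun p w ↦ w p.1 * w p.2.1 * w p.2.2.1 * w p.2.2.2)
      (G := fun p h ↦ h p.1 * h p.2.1 * h p.2.2.1 * h p.2.2.2) (c := _)
      (fun _ ↦ by fun_prop) (fun _ ↦ by fun_prop) (fun p ↦ i₄ p.1 p.2.1 p.2.2.1 p.2.2.2)
      (fun p ↦ hH.integrable_mul_and_integral_mul_four p.1 p.2.1 p.2.2.1 p.2.2.2)
    have e : (fun ω ↦ ∑ p : S × S × S × S, W p.1 ω * W p.2.1 ω * W p.2.2.1 ω * W p.2.2.2 ω *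
        (H p.1 ω * H p.2.1 ω * H p.2.2.1 ω * H p.2.2.2 ω)) = fun ω ↦ m 1 ω ^ 4 := by
      ext ω
      rw [show m 1 ω ^ 4 = m 1 ω * (m 1 ω * (m 1 ω * m 1 ω)) by ring]
      simp only [hm, sum_mul_sum_eq_sum_prod]
      exact Finset.sum_congr rfl fun p _ ↦ by ring
    have e' : (fun ω ↦ ∑ p : S × S × S × S, W p.1 ω * W p.2.1 ω * W p.2.2.1 ω * W p.2.2.2 ω *
        (C p.1 p.2.1 * C p.2.2.1 p.2.2.2 + C p.1 p.2.2.1 * C p.2.1 p.2.2.2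
          + C p.1 p.2.2.2 * C p.2.1 p.2.2.1)) = fun ω ↦ 3 * u ω := by
      ext ω
      have s₁ : u ω = ∑ a, ∑ b, ∑ c, ∑ d,
          W a ω * W b ω * W c ω * W d ω * (C a c * C b d) := by
        refine Finset.sum_congr rfl fun a _ ↦ ?_
        rw [Finset.sum_comm]
        refine Finset.sum_congr rfl fun b _ ↦ Finset.sum_congr rfl fun c _ ↦
          Finset.sum_congr rfl fun d _ ↦ by ring
      have s₂ : u ω = ∑ a, ∑ b, ∑ c, ∑ d,
          W a ω * W b ω * W c ω * W d ω * (C a d * C b c) := by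
        rw [s₁]
        refine Finset.sum_congr rfl fun a _ ↦ Finset.sum_congr rfl fun b _ ↦ ?_
        rw [Finset.sum_comm]
        refine Finset.sum_congr rfl fun c _ ↦ Finset.sum_congr rfl fun d _ ↦ by ring
      refine Eq.trans ?_ (show u ω + u ω + u ω = 3 * u ω by ring)
      refine Eq.trans ?_ (congrArg₂ (· + ·) (congrArg (u ω + ·) s₁.symm) s₂.symm)
      simp only [hu, Fintype.sum_prod_type, mul_add, Finset.sum_add_distrib]
    rwa [e, e', integral_const_mul] at this
  refine ⟨⟨j₂.1.sub j₁₁.1, ?_⟩, ?_⟩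
  · rw [integral_sub j₂.1 j₁₁.1, j₂.2, j₁₁.2]
  · have k₁ := j₄.1.sub (j₃₁.1.const_mul 4)
    have k₂ := k₁.sub (j₂₂.1.const_mul 3)
    have k₃ := k₂.add (j₂₁₁.1.const_mul 12)
    refine ⟨k₃.sub (j₁₁₁₁.1.const_mul 6), ?_⟩
    refine (integral_sub k₃ (j₁₁₁₁.1.const_mul 6)).trans ?_
    rw [integral_add' k₂ (j₂₁₁.1.const_mul 12),
      integral_sub' k₁ (j₂₂.1.const_mul 3), integral_sub' j₄.1 (j₃₁.1.const_mul 4)]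
    simp only [integral_const_mul, j₄.2, j₃₁.2, j₂₂.2, j₂₁₁.2, j₁₁₁₁.2]
    ring

end Cumulants

/-- Aizenman–Contucci identity from stochastic stability: if
`E[ln Σ_τ W_τ exp(λ H_τ)] = a λ²` for all `|λ| < ε`, then `a = (1 − ⟨C₁₂⟩)/2` and
`⟨C₁₂²⟩ − 4⟨C₁₂C₁₃⟩ + 3⟨C₁₂C₃₄⟩ = 0`. -/
theorem aizenman_contucci_from_stability
    {Ωs : Type*} [MeasurableSpace Ωs] (P : Measure Ωs) [IsProbabilityMeasure P]
    {S : Type*} [Fintype S] [Nonempty S]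
    (C : S → S → ℝ)
    (hsymm : ∀ a b, C a b = C b a)
    (hpsd : ∀ v : S → ℝ, 0 ≤ ∑ a : S, ∑ b : S, v a * v b * C a b)
    (hdiag : ∀ a, C a a = 1)
    (H : S → Ωs → ℝ) (hHmeas : ∀ a, Measurable (H a))
    (hGauss : ∀ v : S → ℝ,
      Measure.map (fun ω => ∑ a : S, v a * H a ω) P =
        gaussianReal 0 (Real.toNNReal (∑ a : S, ∑ b : S, v a * v b * C a b)))
    (W : S → Ωs → ℝ) (hWmeas : ∀ a, Measurable (W a))
    (hW : ∀ᵐ ω ∂P, (∀ a, 0 ≤ W a ω) ∧ ∑ a : S, W a ω = 1)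
    (hindep : IndepFun (fun ω a => W a ω) (fun ω a => H a ω) P)
    (ε a : ℝ) (hε : 0 < ε)
    (hstab : ∀ lam : ℝ, |lam| < ε →
      ∫ ω, Real.log (∑ τ : S, W τ ω * Real.exp (lam * H τ ω)) ∂P = a * lam ^ 2) :
    a = (1 - (∫ ω, ∑ τ₁ : S, ∑ τ₂ : S, W τ₁ ω * W τ₂ ω * C τ₁ τ₂ ∂P)) / 2 ∧
    (∫ ω, ∑ τ₁ : S, ∑ τ₂ : S, W τ₁ ω * W τ₂ ω * (C τ₁ τ₂) ^ 2 ∂P)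
      - 4 * (∫ ω, ∑ τ₁ : S, ∑ τ₂ : S, ∑ τ₃ : S,
          W τ₁ ω * W τ₂ ω * W τ₃ ω * (C τ₁ τ₂ * C τ₁ τ₃) ∂P)
      + 3 * (∫ ω, ∑ τ₁ : S, ∑ τ₂ : S, ∑ τ₃ : S, ∑ τ₄ : S,
          W τ₁ ω * W τ₂ ω * W τ₃ ω * W τ₄ ω * (C τ₁ τ₂ * C τ₃ τ₄) ∂P) = 0 := by
  have hH : IsCenteredGaussianFamily P C H := ⟨hsymm, hpsd, hHmeas, hGauss⟩
  set m : ℕ → Ωs → ℝ := fun k ω ↦ ∑ b, W b ω * H b ω ^ k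
  obtain ⟨⟨i₂, e₂⟩, i₄, e₄⟩ :=
    integrable_and_integral_cumulants hH hdiag hWmeas hW hindep m fun _ _ ↦ rfl
  set κ₂ := ∫ ω, m 2 ω - m 1 ω ^ 2 ∂P
  set κ₄ := ∫ ω, m 4 ω - 4 * (m 3 ω * m 1 ω) - 3 * m 2 ω ^ 2
        + 12 * (m 2 ω * m 1 ω ^ 2) - 6 * m 1 ω ^ 4 ∂P
  set M : Ωs → ℝ := fun ω ↦ ∑ b, |H b ω|
  have hM (ω : Ωs) (b : S) : |H b ω| ≤ M ω :=
    Finset.single_le_sum (f := fun b ↦ |H b ω|) (fun _ _ ↦ abs_nonneg _) (Finset.mem_univ b)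
  have hM₁ : Integrable M P := by simpa using hH.integrable_sum_abs_pow one_ne_zero
  have hM₅ : Integrable (fun ω ↦ M ω ^ 5) P := hH.integrable_sum_abs_pow (by decide)
  have hlog (x : ℝ) : Integrable (fun ω ↦ Real.log (∑ b, W b ω * Real.exp (x * H b ω))) P := by
    refine (hM₁.mul_const |x|).mono'
      (Real.measurable_log.comp (by fun_prop)).aestronglyMeasurable ?_
    filter_upwards [hW] with ω hω
    exact abs_log_sum_exp_le hω.1 hω.2 (hM ω) x
  obtain ⟨h₂, h₄⟩ := coeff_eq_zero_of_abs_le (q := 2 * a - κ₂) (t := -κ₄ / 12)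
    (K := 300 * ∫ ω, M ω ^ 5 ∂P) hε fun x hx hxε ↦ by
      have hs₁ := hstab x (by rwa [abs_of_pos hx])
      have hs₂ := hstab (-x) (by rwa [abs_neg, abs_of_pos hx])
      have hl := (hlog x).fun_add (hlog (-x))
      have hp := (i₂.mul_const (x ^ 2)).fun_add ((i₄.div_const 12).mul_const (x ^ 4))
      have hb := norm_integral_le_of_norm_le (f := fun ω ↦
          (Real.log (∑ b, W b ω * Real.exp (x * H b ω))
            + Real.log (∑ b, W b ω * Real.exp (-x * H b ω)))
          - ((m 2 ω - m 1 ω ^ 2) * x ^ 2 + (m 4 ω - 4 * (m 3 ω * m 1 ω) - 3 * m 2 ω ^ 2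
            + 12 * (m 2 ω * m 1 ω ^ 2) - 6 * m 1 ω ^ 4) / 12 * x ^ 4))
        ((hM₅.const_mul 300).mul_const (|x| ^ 5))
        (hW.mono fun ω hω ↦ abs_log_sum_exp_add_log_sum_exp_neg_sub_le hω.1 hω.2 (hM ω)
          (fun k ↦ m k ω) (fun _ ↦ rfl) x)
      rw [integral_sub hl hp, integral_add (hlog x) (hlog (-x)), hs₁, hs₂,
        integral_add (i₂.mul_const (x ^ 2)) ((i₄.div_const 12).mul_const (x ^ 4)),
        integral_mul_const, integral_mul_const, integral_div, integral_mul_const,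
        integral_const_mul, abs_of_pos hx, Real.norm_eq_abs] at hb
      convert hb using 2
      ring
  constructor <;> linarith
end
end
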